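/- arXiv:2011.02244 — 4 statements merged into one kernel-verified Lean document; each statement's English description precedes it below -/
import Mathlib

section
/- Let p, q ∈ ℤ² with p∧q ≠ 0, and fix ν > 0 and λ > 0. Define K_λ : ℓ²(ℤ,ℝ) → ℓ²(ℤ,ℝ) by (K_λ w)_n = (ρ_{n−1}w_{n−1} − ρ_{n+1}w_{n+1}) / (−ν‖q+np‖² − λ). Then K_λ is a compact continuous linear operator on ℓ²(ℤ,ℝ), and there exists a nonzero w ∈ ℓ²(ℤ,ℝ) satisfying ρ_{n−1}w_{n−1} − ρ_{n+1}w_{n+1} − ν‖q+np‖² w_n = λ w_n for all n ∈ ℤ if and only if −1 is an eigenvalue of K_λ, i.e., there exists a nonzero w ∈ ℓ²(ℤ,ℝ) with K_λ w = −w. -/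
open Filter Finset Topology

noncomputable section

/-- Squared Euclidean norm of an integer vector. -/
def nsq (v : ℤ × ℤ) : ℝ := (v.1 : ℝ) ^ 2 + (v.2 : ℝ) ^ 2

/-- Wedge (cross) product of two integer vectors. -/
def wedge (p q : ℤ × ℤ) : ℤ := p.1 * q.2 - p.2 * q.1

/-- The lattice point `q + n • p`. -/
def pt (q p : ℤ × ℤ) (n : ℤ) : ℤ × ℤ := (q.1 + n * p.1, q.2 + n * p.2)

/-- ρ_n = 1 - ‖p‖²/‖q+np‖². -/
def rho (p q : ℤ × ℤ) (n : ℤ) : ℝ := 1 - nsq p / nsq (pt q p n)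

/-- `q` is of type I₀ relative to `p`. -/
def typeI0 (p q : ℤ × ℤ) : Prop :=
  nsq q < nsq p ∧ ∀ n : ℤ, n ≠ 0 → nsq p < nsq (pt q p n)

/-- a_n(λ,ν) = (λ + ν‖q+np‖²)/ρ_n. -/
def acoef (p q : ℤ × ℤ) (lam ν : ℝ) (n : ℤ) : ℝ :=
  (lam + ν * nsq (pt q p n)) / rho p q n

/-- Membership in the weighted space ℓ²_s(ℤ). -/
def memL2s (s : ℝ) (w : ℤ → ℝ) : Prop :=
  Summable fun n : ℤ => (1 + |(n : ℝ)| ^ (2 * s)) * (w n) ^ 2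

/-- Finite continued fraction `[x₁; x₂; …; x_k] = 1/(x₁ + 1/(x₂ + ⋯ + 1/x_k))`. -/
def cfL : List ℝ → ℝ
  | [] => 0
  | x :: xs => 1 / (x + cfL xs)

lemma aux_nsq_nonneg (v : ℤ × ℤ) : 0 ≤ nsq v := by unfold nsq; positivity

lemma aux_one_le_nsq (v : ℤ × ℤ) (hv : v.1 ≠ 0 ∨ v.2 ≠ 0) : 1 ≤ nsq v := by
  have h : (1 : ℤ) ≤ v.1 ^ 2 + v.2 ^ 2 := by
    have h1 := sq_nonneg v.1
    have h2 := sq_nonneg v.2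
    rcases hv with h | h
    · have : 0 < v.1 ^ 2 := by positivity
      omega
    · have : 0 < v.2 ^ 2 := by positivity
      omega
  unfold nsq
  exact_mod_cast h

lemma aux_one_le_pt (p q : ℤ × ℤ) (hpq : wedge p q ≠ 0) (n : ℤ) : 1 ≤ nsq (pt q p n) := by
  apply aux_one_le_nsq
  by_contra! h
  apply hpq
  simp only [pt] at h
  unfold wedge
  linear_combination p.1 * h.2 - p.2 * h.1

lemma aux_one_le_p (p q : ℤ × ℤ) (hpq : wedge p q ≠ 0) : 1 ≤ nsq p := by
  apply aux_one_le_nsq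
  by_contra! h
  apply hpq
  simp [wedge, h.1, h.2]

lemma aux_rho (p q : ℤ × ℤ) (hpq : wedge p q ≠ 0) (n : ℤ) : |rho p q n| ≤ 1 + nsq p := by
  have h1 := aux_one_le_pt p q hpq n
  have h2 := aux_nsq_nonneg p
  have h3 : nsq p / nsq (pt q p n) ≤ nsq p := div_le_self h2 h1
  have h4 : 0 ≤ nsq p / nsq (pt q p n) := by positivity
  unfold rho
  rw [abs_le]
  constructor <;> linarith

lemma aux_growth (p q : ℤ × ℤ) (hpq : wedge p q ≠ 0) (n : ℤ) :
    (n : ℝ) ^ 2 ≤ (2 + 2 * nsq q) * nsq (pt q p n) := by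
  have h1 := aux_one_le_pt p q hpq n
  have h2 := aux_one_le_p p q hpq
  have h3 := aux_nsq_nonneg q
  have h4 : (n : ℝ) ^ 2 * nsq p ≤ 2 * nsq (pt q p n) + 2 * nsq q := by
    simp only [nsq, pt]
    push_cast
    nlinarith [sq_nonneg (2 * (q.1 : ℝ) + n * p.1), sq_nonneg (2 * (q.2 : ℝ) + n * p.2)]
  nlinarith [sq_nonneg (n : ℝ)]

abbrev auxE := lp (fun _ : ℤ => ℝ) 2

def auxEv (n : ℤ) : auxE →L[ℝ] ℝ := lp.evalCLM ℝ (fun _ : ℤ => ℝ) 2 n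

lemma auxEv_apply (n : ℤ) (w : auxE) : auxEv n w = (w : ∀ _ : ℤ, ℝ) n := rfl

lemma auxEv_norm (n : ℤ) : ‖auxEv n‖ ≤ 1 :=
  ContinuousLinearMap.opNorm_le_bound _ zero_le_one fun w => by
    rw [one_mul]; exact lp.norm_apply_le_norm (by norm_num) w n

def auxF (p q : ℤ × ℤ) (ν lam : ℝ) (n : ℤ) : auxE →L[ℝ] ℝ :=
  (-ν * nsq (pt q p n) - lam)⁻¹ •
    (rho p q (n - 1) • auxEv (n - 1) - rho p q (n + 1) • auxEv (n + 1))

def auxR (p q : ℤ × ℤ) (ν lam : ℝ) (n : ℤ) : auxE →L[ℝ] auxE :=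
  (auxF p q ν lam n).smulRight (lp.single 2 n (1 : ℝ))

lemma auxF_norm (p q : ℤ × ℤ) (hpq : wedge p q ≠ 0)
    (ν lam : ℝ) (hν : 0 < ν) (hlam : 0 < lam) (n : ℤ) (hn : n ≠ 0) :
    ‖auxF p q ν lam n‖ ≤ ((2 + 2 * nsq q) / ν * (2 * (1 + nsq p))) * (1 / (n : ℝ) ^ 2) := by
  have h1 := aux_one_le_pt p q hpq n
  have h0 := aux_nsq_nonneg p
  have hq := aux_nsq_nonneg q
  have hb : ∀ m, ‖rho p q m • auxEv m‖ ≤ 1 + nsq p := fun m => by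
    rw [norm_smul]
    calc _ ≤ (1 + nsq p) * 1 :=
          mul_le_mul (aux_rho p q hpq m) (auxEv_norm m) (norm_nonneg _) (by positivity)
      _ = _ := mul_one _
  have h2 : ‖rho p q (n - 1) • auxEv (n - 1) - rho p q (n + 1) • auxEv (n + 1)‖
      ≤ 2 * (1 + nsq p) := (norm_sub_le _ _).trans (by linarith [hb (n - 1), hb (n + 1)])
  have hn2 : 0 < (n : ℝ) ^ 2 := by positivity
  have h3 : ‖(-ν * nsq (pt q p n) - lam)⁻¹‖ ≤ (2 + 2 * nsq q) / ν * (1 / (n : ℝ) ^ 2) := by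
    have hp : 0 < ν * nsq (pt q p n) := by positivity
    rw [norm_inv, Real.norm_eq_abs, abs_of_neg (by linarith), div_mul_div_comm, mul_one,
      inv_le_comm₀ (by linarith) (by positivity), inv_div,
      div_le_iff₀ (by positivity)]
    have := aux_growth p q hpq n
    nlinarith [mul_le_mul_of_nonneg_left this hν.le, mul_nonneg hlam.le hq]
  unfold auxF
  rw [norm_smul]
  calc _ ≤ ((2 + 2 * nsq q) / ν * (1 / (n : ℝ) ^ 2)) * (2 * (1 + nsq p)) :=
        mul_le_mul h3 h2 (norm_nonneg _) (by positivity)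
    _ = _ := by ring

lemma auxR_summable (p q : ℤ × ℤ) (hpq : wedge p q ≠ 0)
    (ν lam : ℝ) (hν : 0 < ν) (hlam : 0 < lam) : Summable (auxR p q ν lam) := by
  refine Summable.of_norm_bounded_eventually
    ((Real.summable_one_div_int_pow (p := 2)).2 one_lt_two |>.mul_left
      ((2 + 2 * nsq q) / ν * (2 * (1 + nsq p)))) ?_
  filter_upwards [(Set.finite_singleton (0 : ℤ)).compl_mem_cofinite] with n hn
  unfold auxR
  rw [ContinuousLinearMap.norm_smulRight_apply, lp.norm_single (by norm_num), norm_one, mul_one]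
  exact auxF_norm p q hpq ν lam hν hlam n hn

lemma auxR_compact (p q : ℤ × ℤ) (ν lam : ℝ) (n : ℤ) : IsCompactOperator (auxR p q ν lam n) :=
  (isCompactOperator_of_locallyCompactSpace_dom (auxF p q ν lam n)).clm_comp
    (ContinuousLinearMap.toSpanSingleton ℝ (lp.single 2 n (1 : ℝ) : auxE))

/-- Fredholm/compact-operator characterization of unstable eigenvalues: the
bidiagonal operator `K_λ` is a compact continuous linear operator on ℓ²(ℤ), and
`λ > 0` is an eigenvalue of `L_{B,q}` iff `-1` is an eigenvalue of `K_λ`. -/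
theorem compactOperator_characterization (p q : ℤ × ℤ) (hpq : wedge p q ≠ 0)
    (ν lam : ℝ) (hν : 0 < ν) (hlam : 0 < lam) :
    ∃ K : lp (fun _ : ℤ => ℝ) 2 →L[ℝ] lp (fun _ : ℤ => ℝ) 2,
      (∀ w : lp (fun _ : ℤ => ℝ) 2, ∀ n : ℤ,
        (K w : ∀ _ : ℤ, ℝ) n =
          (rho p q (n - 1) * (w : ∀ _ : ℤ, ℝ) (n - 1)
            - rho p q (n + 1) * (w : ∀ _ : ℤ, ℝ) (n + 1)) /
          (-ν * nsq (pt q p n) - lam)) ∧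
      IsCompactOperator K ∧
      ((∃ w : lp (fun _ : ℤ => ℝ) 2, w ≠ 0 ∧ ∀ n : ℤ,
          rho p q (n - 1) * (w : ∀ _ : ℤ, ℝ) (n - 1)
            - rho p q (n + 1) * (w : ∀ _ : ℤ, ℝ) (n + 1)
            - ν * nsq (pt q p n) * (w : ∀ _ : ℤ, ℝ) n
          = lam * (w : ∀ _ : ℤ, ℝ) n) ↔
        (∃ w : lp (fun _ : ℤ => ℝ) 2, w ≠ 0 ∧ K w = -w)) := by
  have hs := (auxR_summable p q hpq ν lam hν hlam).hasSum
  have hD : ∀ n, -ν * nsq (pt q p n) - lam ≠ 0 := fun n => by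
    have := mul_nonneg hν.le (aux_nsq_nonneg (pt q p n))
    linarith
  have hK : ∀ w : lp (fun _ : ℤ => ℝ) 2, ∀ n : ℤ,
        (((∑' m, auxR p q ν lam m) w : lp (fun _ : ℤ => ℝ) 2) : ∀ _ : ℤ, ℝ) n =
          (rho p q (n - 1) * (w : ∀ _ : ℤ, ℝ) (n - 1)
            - rho p q (n + 1) * (w : ∀ _ : ℤ, ℝ) (n + 1)) /
          (-ν * nsq (pt q p n) - lam) := by
    intro w n
    have h1 := hs.mapL ((auxEv n).comp (ContinuousLinearMap.apply ℝ auxE w))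
    have h2 : ∀ m, m ≠ n →
        ((auxEv n).comp (ContinuousLinearMap.apply ℝ auxE w)) (auxR p q ν lam m) = 0 := by
      intro m hm
      simp [auxR, auxEv_apply, lp.single_apply, hm.symm]
    have h3 := h1.unique (hasSum_single n h2)
    refine h3.trans ?_
    simp [auxR, auxF, auxEv_apply, lp.single_apply]
    ring
  refine ⟨∑' m, auxR p q ν lam m, hK, ?_, ?_⟩
  · refine isCompactOperator_of_tendsto hs (Eventually.of_forall fun s => ?_)
    exact Submodule.sum_mem (compactOperator (RingHom.id ℝ) auxE auxE)
      fun m _ => auxR_compact p q ν lam m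
  · refine exists_congr fun w => and_congr_right fun _ => ?_
    constructor
    · intro h
      ext n
      rw [hK, div_eq_iff (hD n)]
      have := h n
      simp only [lp.coeFn_neg, Pi.neg_apply]
      linarith
    · intro h n
      have := hK w n
      rw [h, eq_div_iff (hD n)] at this
      simp only [lp.coeFn_neg, Pi.neg_apply] at this
      linarith
end
end

section
/- Fix α > 0. Let p, q ∈ ℤ² with p∧q ≠ 0 and suppose q is of type I₀ relative to p, and set ρ″_n = (1 − ‖p‖²/‖q+np‖²) / (1+α²‖q+np‖²). Then there exists ν₀ > 0 such that for every ν ∈ (0, ν₀) there exist λ > 0 and a sequence w:ℤ→ℝ, not identically zero, belonging to ℓ²_s(ℤ) for every s ≥ 0, satisfying the Navier–Stokes–Voigt eigenvalue recurrence ρ″_{n−1}w_{n−1} − ρ″_{n+1}w_{n+1} − ν‖q+np‖²(1+α²‖q+np‖²)^{−1} w_n = λ w_n for all n ∈ ℤ. In particular, the linearized Navier–Stokes–Voigt operator about the unidirectional steady state has a positive eigenvalue. -/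
open Filter Finset Topology

noncomputable section

/-- ρ″_n for the Navier-Stokes-Voigt model. -/
def rhoVoigt (α : ℝ) (p q : ℤ × ℤ) (n : ℤ) : ℝ :=
  (1 - nsq p / nsq (pt q p n)) / (1 + α ^ 2 * nsq (pt q p n))

/-- truncated continued fraction starting at index `n` with `K` terms -/
def cfT (a : ℕ → ℝ) : ℕ → ℕ → ℝ
  | _, 0 => 0
  | n, K + 1 => 1 / (a n + cfT a (n + 1) K)

lemma cfT_nonneg (a : ℕ → ℝ) (ha : ∀ n, 0 < a n) : ∀ K n, 0 ≤ cfT a n K := by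
  intro K
  induction K with
  | zero => intro n; simp [cfT]
  | succ K ih =>
    intro n
    have := ih (n + 1)
    have := ha n
    simp only [cfT]; positivity

lemma cfT_le (a : ℕ → ℝ) (ha : ∀ n, 0 < a n) (K n : ℕ) : cfT a n K ≤ 1 / a n := by
  cases K with
  | zero => have := ha n; simp only [cfT]; positivity
  | succ K =>
    have h1 := cfT_nonneg a ha K (n + 1)
    have := ha n
    simp only [cfT]
    apply one_div_le_one_div_of_le this; linarith

lemma cfT_inv (a : ℕ → ℝ) (ha : ∀ n, 0 < a n) (n K : ℕ) (t : ℝ) (ht : 0 < t)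
    (h : t ≤ a (n + 1) + cfT a (n + 2) K) :
    0 < cfT a n (K + 2) ∧ 1 / cfT a n (K + 2) ≤ a n + 1 / t := by
  have h1 := ha n
  have h3 : 1 / (a (n + 1) + cfT a (n + 2) K) ≤ 1 / t := one_div_le_one_div_of_le ht h
  have h2 : 0 < 1 / (a (n + 1) + cfT a (n + 2) K) := by
    apply one_div_pos.2; linarith
  simp only [cfT]
  refine ⟨by positivity, ?_⟩
  rw [one_div_one_div]
  linarith

lemma cfT_lower (a : ℕ → ℝ) (ha : ∀ n, 0 < a n) : ∀ (m n K : ℕ), 2 * m + 2 ≤ K →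
    0 < cfT a n K ∧
      1 / cfT a n K ≤ ∑ j ∈ Finset.range (m + 1), a (n + 2 * j) + 1 / a (n + 2 * m + 1) := by
  intro m
  induction m with
  | zero =>
    intro n K hK
    obtain ⟨K, rfl⟩ := Nat.exists_eq_add_of_le hK
    have := cfT_inv a ha n K (a (n + 1)) (ha _) (by have := cfT_nonneg a ha K (n + 2); linarith)
    rw [show 2 * 0 + 2 + K = K + 2 by ring]
    simpa using this
  | succ m ih =>
    intro n K hK
    obtain ⟨K, rfl⟩ := Nat.exists_eq_add_of_le' (show 2 ≤ K by omega)
    obtain ⟨h1, h2⟩ := ih (n + 2) K (by omega)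
    obtain ⟨h3, h4⟩ := cfT_inv a ha n K _ h1 (by have := ha (n + 1); linarith)
    refine ⟨h3, ?_⟩
    rw [Finset.sum_range_succ']
    have e : ∀ j, n + 2 * (j + 1) = n + 2 + 2 * j := fun j => by ring
    simp only [e]
    rw [show n + 2 + 2 * m + 1 = n + 2 + 2 * m + 1 by ring]
    simp only [Nat.mul_zero, Nat.add_zero]
    linarith

lemma cfT_cont (a : ℝ → ℕ → ℝ) (s : Set ℝ) (ha : ∀ l ∈ s, ∀ n, 0 < a l n)
    (hc : ∀ n, ContinuousOn (fun l => a l n) s) :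
    ∀ K n, ContinuousOn (fun l => cfT (a l) n K) s := by
  intro K
  induction K with
  | zero => intro n; simp only [cfT]; exact continuousOn_const
  | succ K ih =>
    intro n
    simp only [cfT]
    refine ContinuousOn.div continuousOn_const ((hc n).add (ih (n + 1))) ?_
    intro l hl
    have h1 := ha l hl n
    have h2 := cfT_nonneg (a l) (ha l hl) K (n + 1)
    exact ne_of_gt (by linarith)

lemma isClosed_bdd_forall {Z : Type*} [TopologicalSpace Z] (K : ℕ) (P : ℕ → Z → Prop)
    (h : ∀ n, IsClosed {z | P n z}) : IsClosed {z | ∀ n, n < K → P n z} := by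
  have : {z | ∀ n, n < K → P n z} = ⋂ n, ⋂ (_ : n < K), {z | P n z} := by
    ext z; simp
  rw [this]
  exact isClosed_iInter fun n => isClosed_iInter fun _ => h n

/-- existence of root and infinite ratio sequences, by compactness -/
lemma exists_ratios (R D R' D' : ℕ → ℝ) (c d0 ν hi : ℝ) (hν : 0 < ν)
    (hR : ∀ n, 0 < R n) (hD : ∀ n, 0 ≤ D n) (hR' : ∀ n, 0 < R' n) (hD' : ∀ n, 0 ≤ D' n)
    (hc : 0 < c) (hd0 : 0 ≤ d0) (hhi : ν ≤ hi) (hhi2 : (R 0 + R' 0) * c ≤ hi * hi)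
    (m : ℕ)
    (hlow : ∀ K, 2 * m + 2 ≤ K →
      (ν + ν * d0) / c ≤ cfT (fun n => (ν + ν * D n) / R n) 0 K) :
    ∃ l > 0, ∃ u v : ℕ → ℝ, (∀ n, 0 ≤ u n) ∧ (∀ n, 0 ≤ v n) ∧
      (∀ n, u n * ((l + ν * D n) + R n * u (n + 1)) = R n) ∧
      (∀ n, v n * ((l + ν * D' n) + R' n * v (n + 1)) = R' n) ∧
      (u 0 + v 0) * c = l + ν * d0 := by
  let B : Set (ℝ × (ℕ → ℝ) × (ℕ → ℝ)) :=
    Set.Icc ν hi ×ˢ ((Set.pi Set.univ fun n => Set.Icc 0 (R n / ν)) ×ˢ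
      (Set.pi Set.univ fun n => Set.Icc 0 (R' n / ν)))
  have hB : IsCompact B :=
    isCompact_Icc.prod ((isCompact_univ_pi fun n => isCompact_Icc).prod
      (isCompact_univ_pi fun n => isCompact_Icc))
  let C : ℕ → Set (ℝ × (ℕ → ℝ) × (ℕ → ℝ)) := fun K =>
    {z | (∀ n, n < K → z.2.1 n * ((z.1 + ν * D n) + R n * z.2.1 (n + 1)) = R n) ∧
      (∀ n, n < K → z.2.2 n * ((z.1 + ν * D' n) + R' n * z.2.2 (n + 1)) = R' n) ∧
      (z.2.1 0 + z.2.2 0) * c = z.1 + ν * d0}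
  have hC : ∀ K, IsClosed (C K) := by
    intro K
    refine IsClosed.inter ?_ (IsClosed.inter ?_ ?_)
    · refine isClosed_bdd_forall K _ fun n => isClosed_eq ?_ ?_ <;> fun_prop
    · refine isClosed_bdd_forall K _ fun n => isClosed_eq ?_ ?_ <;> fun_prop
    · refine isClosed_eq ?_ ?_ <;> fun_prop
  have hne : ∀ K, (B ∩ C K).Nonempty := by
    intro K0
    obtain ⟨K, hK0, hK⟩ : ∃ K, K0 ≤ K ∧ 2 * m + 2 ≤ K :=
      ⟨max K0 (2 * m + 2), le_max_left _ _, le_max_right _ _⟩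
    let a : ℝ → ℕ → ℝ := fun l n => (l + ν * D n) / R n
    let a' : ℝ → ℕ → ℝ := fun l n => (l + ν * D' n) / R' n
    have hpos : ∀ l ∈ Set.Icc ν hi, ∀ n, 0 < a l n := by
      intro l hl n
      have := hR n; have := hD n
      have : 0 < l := lt_of_lt_of_le hν hl.1
      simp only [a]; positivity
    have hpos' : ∀ l ∈ Set.Icc ν hi, ∀ n, 0 < a' l n := by
      intro l hl n
      have := hR' n; have := hD' n
      have : 0 < l := lt_of_lt_of_le hν hl.1
      simp only [a']; positivity
    have hup : ∀ l ∈ Set.Icc ν hi, ∀ n, 1 / a l n ≤ R n / l := by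
      intro l hl n
      have h1 := hR n; have h2 := hD n
      have : 0 < l := lt_of_lt_of_le hν hl.1
      simp only [a]; rw [one_div_div]
      have := mul_nonneg hν.le h2
      gcongr; linarith
    have hup' : ∀ l ∈ Set.Icc ν hi, ∀ n, 1 / a' l n ≤ R' n / l := by
      intro l hl n
      have h1 := hR' n; have h2 := hD' n
      have : 0 < l := lt_of_lt_of_le hν hl.1
      simp only [a']; rw [one_div_div]
      have := mul_nonneg hν.le h2
      gcongr; linarith
    have hct : ∀ n, ContinuousOn (fun l => cfT (a l) n K) (Set.Icc ν hi) :=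
      cfT_cont a _ hpos (fun n => by simp only [a]; fun_prop) K
    have hct' : ∀ n, ContinuousOn (fun l => cfT (a' l) n K) (Set.Icc ν hi) :=
      cfT_cont a' _ hpos' (fun n => by simp only [a']; fun_prop) K
    have hG : ContinuousOn (fun l => l + ν * d0 - (cfT (a l) 0 K + cfT (a' l) 0 K) * c)
        (Set.Icc ν hi) := by
      have h1 := hct 0
      have h2 := hct' 0
      fun_prop
    have hmem : (0 : ℝ) ∈ Set.Icc (ν + ν * d0 - (cfT (a ν) 0 K + cfT (a' ν) 0 K) * c)
        (hi + ν * d0 - (cfT (a hi) 0 K + cfT (a' hi) 0 K) * c) := by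
      constructor
      · have h1 := hlow K hK
        rw [div_le_iff₀ hc] at h1
        have h2 := cfT_nonneg (a' ν) (hpos' ν ⟨le_rfl, hhi⟩) K 0
        have h3 := mul_nonneg h2 hc.le
        have h1' : ν + ν * d0 ≤ cfT (a ν) 0 K * c := h1
        linarith
      · have hm : hi ∈ Set.Icc ν hi := ⟨hhi, le_rfl⟩
        have hp : 0 < hi := lt_of_lt_of_le hν hhi
        have h1 := (cfT_le (a hi) (hpos hi hm) K 0).trans (hup hi hm 0)
        have h2 := (cfT_le (a' hi) (hpos' hi hm) K 0).trans (hup' hi hm 0)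
        have h3 : (R 0 / hi + R' 0 / hi) * c ≤ hi := by
          rw [← add_div, div_mul_eq_mul_div, div_le_iff₀ hp]; exact hhi2
        have h4 : (cfT (a hi) 0 K + cfT (a' hi) 0 K) * c ≤ (R 0 / hi + R' 0 / hi) * c := by
          gcongr
        have := mul_nonneg hν.le hd0
        linarith
    obtain ⟨l, hl, hl0⟩ := intermediate_value_Icc hhi hG hmem
    have hlpos : 0 < l := lt_of_lt_of_le hν hl.1
    refine ⟨(l, fun n => cfT (a l) n (K - n), fun n => cfT (a' l) n (K - n)),
      ⟨hl, ?_, ?_⟩, ?_, ?_, ?_⟩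
    · intro n _
      refine ⟨cfT_nonneg _ (hpos l hl) _ _, ((cfT_le _ (hpos l hl) _ _).trans (hup l hl n)).trans ?_⟩
      exact div_le_div_of_nonneg_left (hR n).le hν hl.1
    · intro n _
      refine ⟨cfT_nonneg _ (hpos' l hl) _ _,
        ((cfT_le _ (hpos' l hl) _ _).trans (hup' l hl n)).trans ?_⟩
      exact div_le_div_of_nonneg_left (hR' n).le hν hl.1
    · intro n hn
      obtain ⟨k, hk⟩ : ∃ k, K - n = k + 1 := ⟨K - n - 1, by omega⟩
      have hk' : K - (n + 1) = k := by omega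
      simp only [hk, hk', cfT]
      have h1 := cfT_nonneg _ (hpos l hl) k (n + 1)
      have h2 := hpos l hl n
      have h3 := hR n
      have h4 : l + ν * D n = a l n * R n := by simp only [a]; field_simp
      rw [h4]
      have : a l n + cfT (a l) (n + 1) k ≠ 0 := by positivity
      field_simp
    · intro n hn
      obtain ⟨k, hk⟩ : ∃ k, K - n = k + 1 := ⟨K - n - 1, by omega⟩
      have hk' : K - (n + 1) = k := by omega
      simp only [hk, hk', cfT]
      have h1 := cfT_nonneg _ (hpos' l hl) k (n + 1)
      have h2 := hpos' l hl n
      have h3 := hR' n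
      have h4 : l + ν * D' n = a' l n * R' n := by simp only [a']; field_simp
      rw [h4]
      have : a' l n + cfT (a' l) (n + 1) k ≠ 0 := by positivity
      field_simp
    · simp only [Nat.sub_zero]
      simp only at hl0
      linarith
  obtain ⟨z, hz⟩ := IsCompact.nonempty_iInter_of_sequence_nonempty_isCompact_isClosed
    (fun K => B ∩ C K)
    (fun K => Set.inter_subset_inter_right _ (fun z hz =>
      ⟨fun n hn => hz.1 n (by omega), fun n hn => hz.2.1 n (by omega), hz.2.2⟩))
    hne (hB.inter_right (hC 0)) (fun K => hB.isClosed.inter (hC K))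
  rw [Set.mem_iInter] at hz
  have hz0 := hz 0
  refine ⟨z.1, lt_of_lt_of_le hν hz0.1.1.1, z.2.1, z.2.2, fun n => (hz0.1.2.1 n trivial).1,
    fun n => (hz0.1.2.2 n trivial).1, fun n => (hz (n + 1)).2.1 n (by omega),
    fun n => (hz (n + 1)).2.2.1 n (by omega), hz0.2.2.2⟩

/-- rapid decay of the products -/
lemma decay_summable (R D u : ℕ → ℝ) (l ν : ℝ) (hl : 0 < l) (hν : 0 < ν)
    (hR : ∀ n, 0 < R n) (hD : ∀ n, 0 ≤ D n) (hlim : Tendsto R atTop (𝓝 0))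
    (hu : ∀ n, 0 ≤ u n) (he : ∀ n, u n * ((l + ν * D n) + R n * u (n + 1)) = R n)
    (s : ℝ) :
    Summable fun k : ℕ => (1 + ((k : ℝ) + 1) ^ (2 * s)) *
      ((∏ i ∈ Finset.range (k + 1), u i) / R k) ^ 2 := by
  have hub : ∀ n, u n ≤ R n / l := by
    intro n
    rw [le_div_iff₀ hl]
    have h1 := mul_nonneg (hu n) (mul_nonneg hν.le (hD n))
    have h2 := mul_nonneg (hu n) (mul_nonneg (hR n).le (hu (n + 1)))
    have := he n
    nlinarith
  have hev : ∀ᶠ n in atTop, u n ≤ 1 / 2 := by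
    have : ∀ᶠ n in atTop, R n < l / 2 := hlim.eventually_lt_const (by positivity)
    filter_upwards [this] with n hn
    refine (hub n).trans ?_
    rw [div_le_iff₀ hl]; linarith
  obtain ⟨N, hN⟩ := eventually_atTop.1 hev
  set X : ℕ → ℝ := fun k => ∏ i ∈ Finset.range k, u i with hX
  have hX0 : ∀ k, 0 ≤ X k := fun k => Finset.prod_nonneg fun i _ => hu i
  have hXb : ∀ k, X (N + k) ≤ X N * (1 / 2) ^ k := by
    intro k
    induction k with
    | zero => simp
    | succ k ih =>
      have : X (N + (k + 1)) = X (N + k) * u (N + k) := by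
        simp only [hX]; rw [← add_assoc, Finset.prod_range_succ]
      rw [this, pow_succ, ← mul_assoc]
      exact mul_le_mul ih (hN _ (by omega)) (hu _) (mul_nonneg (hX0 _) (by positivity))
  obtain ⟨M, hM⟩ := exists_nat_ge (2 * s)
  rw [← summable_nat_add_iff N]
  have hbase : Summable fun k : ℕ => ((k : ℝ) ^ M) * (1 / 4 : ℝ) ^ k :=
    summable_pow_mul_geometric_of_norm_lt_one M (by norm_num)
  have hbase2 := ((summable_nat_add_iff (N + 1)).2 hbase).mul_left
    (2 * (X N / l) ^ 2 * 4 ^ (N + 1))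
  refine Summable.of_nonneg_of_le (fun k => ?_) (fun k => ?_) hbase2
  · positivity
  · have h1 : X (k + N + 1) / R (k + N) ≤ X N / l * (1 / 2) ^ k := by
      have e : X (k + N + 1) = X (N + k) * u (k + N) := by
        simp only [hX]; rw [Finset.prod_range_succ, add_comm k N]
      rw [e, div_le_iff₀ (hR _)]
      calc X (N + k) * u (k + N) ≤ (X N * (1 / 2) ^ k) * (R (k + N) / l) :=
            mul_le_mul (hXb k) (hub _) (hu _) (mul_nonneg (hX0 _) (by positivity))
        _ = _ := by ring
    have h1' : 0 ≤ X (k + N + 1) / R (k + N) := div_nonneg (hX0 _) (hR _).le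
    have h2 : (X (k + N + 1) / R (k + N)) ^ 2 ≤ (X N / l) ^ 2 * (1 / 4) ^ k := by
      calc _ ≤ (X N / l * (1 / 2) ^ k) ^ 2 := by gcongr
        _ = _ := by rw [mul_pow, ← pow_mul, mul_comm k 2, pow_mul]; norm_num
    have hb1 : (1 : ℝ) ≤ ((k + N : ℕ) : ℝ) + 1 := by
      have : (0 : ℝ) ≤ ((k + N : ℕ) : ℝ) := Nat.cast_nonneg _
      linarith
    have h3 : 1 + (((k + N : ℕ) : ℝ) + 1) ^ (2 * s) ≤ 2 * (((k + N : ℕ) : ℝ) + 1) ^ M := by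
      have h4 : (((k + N : ℕ) : ℝ) + 1) ^ (2 * s) ≤ (((k + N : ℕ) : ℝ) + 1) ^ M := by
        rw [← Real.rpow_natCast]
        exact Real.rpow_le_rpow_of_exponent_le hb1 hM
      have h5 : 1 ≤ (((k + N : ℕ) : ℝ) + 1) ^ M := one_le_pow₀ hb1
      linarith
    calc _ ≤ (2 * (((k + N : ℕ) : ℝ) + 1) ^ M) * ((X N / l) ^ 2 * (1 / 4) ^ k) := by
          refine mul_le_mul h3 h2 (by positivity) (by positivity)
      _ = _ := by
          have : ((1 / 4 : ℝ)) ^ (k + (N + 1)) = (1 / 4) ^ k * (1 / 4) ^ (N + 1) := pow_add _ _ _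
          rw [this]
          have h6 : (4 : ℝ) ^ (N + 1) * (1 / 4) ^ (N + 1) = 1 := by
            rw [← mul_pow]; norm_num
          push_cast
          linear_combination (-(2 * ((k : ℝ) + N + 1) ^ M * (X N / l) ^ 2 * (1 / 4) ^ k)) * h6

lemma abstract_main (r d : ℤ → ℝ) (hr0 : r 0 < 0) (hr : ∀ n, n ≠ 0 → 0 < r n)
    (hd : ∀ n, 0 ≤ d n)
    (hlim : Tendsto (fun k : ℕ => r ((k : ℤ) + 1)) atTop (𝓝 0))
    (hlim' : Tendsto (fun k : ℕ => r (-((k : ℤ) + 1))) atTop (𝓝 0)) :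
    ∃ ν₀ > (0 : ℝ), ∀ ν : ℝ, 0 < ν → ν < ν₀ →
      ∃ lam > (0 : ℝ), ∃ w : ℤ → ℝ, w ≠ 0 ∧ (∀ s : ℝ, 0 ≤ s → memL2s s w) ∧
        ∀ n : ℤ, r (n - 1) * w (n - 1) - r (n + 1) * w (n + 1) - ν * d n * w n = lam * w n := by
  set R : ℕ → ℝ := fun k => r ((k : ℤ) + 1) with hRdef
  set R' : ℕ → ℝ := fun k => r (-((k : ℤ) + 1)) with hRdef'
  set D : ℕ → ℝ := fun k => d ((k : ℤ) + 1) with hDdef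
  set D' : ℕ → ℝ := fun k => d (-((k : ℤ) + 1)) with hDdef'
  have hR : ∀ n, 0 < R n := fun n => hr _ (by omega)
  have hR' : ∀ n, 0 < R' n := fun n => hr _ (by omega)
  have hD : ∀ n, 0 ≤ D n := fun n => hd _
  have hD' : ∀ n, 0 ≤ D' n := fun n => hd _
  set c := -r 0 with hcdef
  have hc : 0 < c := by simp only [hcdef]; linarith
  have hd0 := hd 0
  set Bq := (1 + d 0) / c with hBq
  have hBpos : 0 < Bq := by positivity
  obtain ⟨N, hN⟩ := eventually_atTop.1 (hlim.eventually_lt_const (show (0 : ℝ) < 1 / Bq by positivity))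
  have hm := hN (2 * N + 1) (by omega)
  set b : ℕ → ℝ := fun n => (1 + D n) / R n with hb
  have hbpos : ∀ n, 0 < b n := fun n => by
    have := hR n; have := hD n; simp only [hb]; positivity
  have hbinv : 1 / b (2 * N + 1) < 1 / Bq := by
    refine lt_of_le_of_lt ?_ hm
    simp only [hb]; rw [one_div_div]
    exact div_le_self (hR _).le (by have := hD (2 * N + 1); linarith)
  set S := ∑ j ∈ Finset.range (N + 1), b (2 * j) with hS
  have hSpos : 0 < S := Finset.sum_pos (fun j _ => hbpos _) ⟨0, by simp⟩
  refine ⟨min 1 ((1 / Bq - 1 / b (2 * N + 1)) / S), lt_min one_pos (div_pos (by linarith) hSpos), ?_⟩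
  intro ν hν hν0
  have hν1 : ν < 1 := lt_of_lt_of_le hν0 (min_le_left _ _)
  have hν2 : ν * S < 1 / Bq - 1 / b (2 * N + 1) :=
    (lt_div_iff₀ hSpos).1 (lt_of_lt_of_le hν0 (min_le_right _ _))
  set hi := max ν (max 1 ((R 0 + R' 0) * c)) with hhi
  have hi1 : 1 ≤ hi := (le_max_left _ _).trans (le_max_right _ _)
  have hi2 : (R 0 + R' 0) * c ≤ hi := (le_max_right _ _).trans (le_max_right _ _)
  obtain ⟨l, hl, u, v, hu, hv, hue, hve, h0⟩ :=
    exists_ratios R D R' D' c (d 0) ν hi hν hR hD hR' hD' hc hd0 (le_max_left _ _)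
      (by nlinarith) N (by
        intro K hK
        have hap : ∀ n, 0 < (ν + ν * D n) / R n := fun n => by
          have := hR n; have := hD n; positivity
        obtain ⟨h1, h2⟩ := cfT_lower (fun n => (ν + ν * D n) / R n) hap N 0 K hK
        have e : ∀ n, (ν + ν * D n) / R n = ν * b n := fun n => by simp only [hb]; ring
        rw [show (fun n => (ν + ν * D n) / R n) = fun n => ν * b n from funext e] at h1 h2 ⊢
        simp only [Nat.zero_add, e] at h2
        rw [← Finset.mul_sum] at h2
        have e2 : (ν + ν * d 0) / c = ν * Bq := by simp only [hBq]; ring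
        rw [e2]
        refine le_of_one_div_le_one_div h1 (h2.trans ?_)
        have h3 : ν * (ν * S) ≤ ν * S := by nlinarith [mul_pos hν hSpos]
        have h4 : ν * (ν * S) + 1 / b (2 * N + 1) ≤ 1 / Bq := by linarith
        have e3 : ν * S + 1 / (ν * b (2 * N + 1)) = (ν * (ν * S) + 1 / b (2 * N + 1)) / ν := by
          have := hbpos (2 * N + 1)
          field_simp
        have e4 : 1 / (ν * Bq) = (1 / Bq) / ν := by field_simp
        rw [e4]
        change ν * S + 1 / (ν * b (2 * N + 1)) ≤ _
        rw [e3]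
        gcongr)
  set X : ℕ → ℝ := fun k => ∏ i ∈ Finset.range k, u i with hX
  set Y : ℕ → ℝ := fun k => ∏ i ∈ Finset.range k, v i with hY
  set x : ℤ → ℝ := fun n => if 0 ≤ n then X n.natAbs else (-1) ^ n.natAbs * Y n.natAbs with hx
  have xp : ∀ k : ℕ, x k = X k := by intro k; simp [hx]
  have xn : ∀ k : ℕ, x (-(k : ℤ)) = (-1) ^ k * Y k := by
    intro k
    rcases Nat.eq_zero_or_pos k with rfl | hk
    · simp [hx, hX, hY]
    · have : ¬ (0 : ℤ) ≤ -(k : ℤ) := by omega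
      simp only [hx, if_neg this, Int.natAbs_neg, Int.natAbs_natCast]
  have rne : ∀ n, r n ≠ 0 := by
    intro n
    rcases eq_or_ne n 0 with rfl | hn
    · exact hr0.ne
    · exact (hr n hn).ne'
  have key : ∀ n, x (n - 1) - x (n + 1) = (l + ν * d n) * (x n / r n) := by
    intro n
    have hcases : n = 0 ∨ (∃ k : ℕ, n = (k : ℤ) + 1) ∨ ∃ k : ℕ, n = -((k : ℤ) + 1) := by
      rcases lt_trichotomy n 0 with h | h | h
      · right; right; exact ⟨(-n - 1).toNat, by omega⟩
      · left; exact h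
      · right; left; exact ⟨(n - 1).toNat, by omega⟩
    rcases hcases with rfl | ⟨k, rfl⟩ | ⟨k, rfl⟩
    · have e1 : x (0 - 1) = -v 0 := by
        have := xn 1
        simpa [hY] using this
      have e2 : x (0 + 1) = u 0 := by
        have := xp 1
        simpa [hX] using this
      have e3 : x 0 = 1 := by
        have := xp 0
        simpa [hX] using this
      rw [e1, e2, e3]
      have := rne 0
      rw [mul_one_div, eq_div_iff this]
      simp only [hcdef] at h0
      linarith
    · have e1 : x ((k : ℤ) + 1 - 1) = X k := by rw [add_sub_cancel_right]; exact xp k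
      have e2 : x ((k : ℤ) + 1 + 1) = X k * u k * u (k + 1) := by
        have := xp (k + 2)
        rw [show (k : ℤ) + 1 + 1 = ((k + 2 : ℕ) : ℤ) by push_cast; ring, this]
        simp only [hX]; rw [Finset.prod_range_succ, Finset.prod_range_succ]
      have e3 : x ((k : ℤ) + 1) = X k * u k := by
        have := xp (k + 1)
        rw [show (k : ℤ) + 1 = ((k + 1 : ℕ) : ℤ) by push_cast; ring, this]
        simp only [hX]; rw [Finset.prod_range_succ]
      rw [e1, e2, e3]
      have h1 := rne ((k : ℤ) + 1)
      have h2 := hue k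
      simp only [hRdef, hDdef] at h2
      rw [← mul_div_assoc, eq_div_iff h1]
      linear_combination (-X k) * h2
    · have e1 : x (-((k : ℤ) + 1) - 1) = (-1) ^ k * (Y k * v k * v (k + 1)) := by
        have := xn (k + 2)
        rw [show -((k : ℤ) + 1) - 1 = -((k + 2 : ℕ) : ℤ) by push_cast; ring, this]
        simp only [hY]; rw [Finset.prod_range_succ, Finset.prod_range_succ]; ring
      have e2 : x (-((k : ℤ) + 1) + 1) = (-1) ^ k * Y k := by
        rw [show -((k : ℤ) + 1) + 1 = -(k : ℤ) by ring]; exact xn k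
      have e3 : x (-((k : ℤ) + 1)) = - ((-1) ^ k * (Y k * v k)) := by
        have := xn (k + 1)
        rw [show -((k : ℤ) + 1) = -((k + 1 : ℕ) : ℤ) by push_cast; ring, this]
        simp only [hY]; rw [Finset.prod_range_succ]; ring
      rw [e1, e2, e3]
      have h1 := rne (-((k : ℤ) + 1))
      have h2 := hve k
      simp only [hRdef', hDdef'] at h2
      rw [← mul_div_assoc, eq_div_iff h1]
      linear_combination ((-1) ^ k * Y k) * h2
  refine ⟨l, hl, fun n => x n / r n, ?_, ?_, ?_⟩
  · intro h
    have h1 := congrFun h 0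
    have e3 : x 0 = 1 := by
      have := xp 0
      simpa [hX] using this
    simp only [e3, Pi.zero_apply] at h1
    exact (one_div_ne_zero (rne 0)) h1
  · intro s hs
    have s1 := decay_summable R D u l ν hl hν hR hD hlim hu hue s
    have s2 := decay_summable R' D' v l ν hl hν hR' hD' hlim' hv hve s
    unfold memL2s
    refine Summable.of_nat_of_neg_add_one ?_ ?_
    · rw [← summable_nat_add_iff 1]
      refine s1.congr fun k => ?_
      have e1 : |(((k + 1 : ℕ) : ℤ) : ℝ)| = (k : ℝ) + 1 := by
        push_cast; exact abs_of_nonneg (by positivity)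
      simp only []
      rw [e1, xp (k + 1)]
      simp [hX, hRdef]
    · refine s2.congr fun k => ?_
      have e1 : |((-((k : ℤ) + 1) : ℤ) : ℝ)| = (k : ℝ) + 1 := by
        push_cast; rw [abs_neg]; exact abs_of_nonneg (by positivity)
      have := xn (k + 1)
      push_cast at this
      simp only []
      rw [e1, this, div_pow, div_pow, mul_pow, ← pow_mul, mul_comm (k + 1) 2, pow_mul]
      simp [hY, hRdef']
  · intro n
    have := key n
    rw [mul_div_cancel₀ _ (rne _), mul_div_cancel₀ _ (rne _)]
    linarith

lemma nsq_pt_lower (p q : ℤ × ℤ) (hp : 1 ≤ nsq p) (n : ℤ) :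
    (n : ℝ) ^ 2 / 2 - nsq q ≤ nsq (pt q p n) := by
  simp only [nsq, pt] at *
  push_cast
  nlinarith [sq_nonneg ((q.1 : ℝ) * 2 + n * p.1), sq_nonneg ((q.2 : ℝ) * 2 + n * p.2),
    mul_nonneg (sq_nonneg (n : ℝ)) (sub_nonneg.2 hp)]

lemma nsq_ge_one (v : ℤ × ℤ) (h : v.1 ≠ 0 ∨ v.2 ≠ 0) : 1 ≤ nsq v := by
  have : (1 : ℤ) ≤ v.1 ^ 2 + v.2 ^ 2 := by
    rcases h with h | h
    · have := pow_pos (abs_pos.2 h) 2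
      rw [sq_abs] at this; nlinarith [sq_nonneg v.2]
    · have := pow_pos (abs_pos.2 h) 2
      rw [sq_abs] at this; nlinarith [sq_nonneg v.1]
  unfold nsq; exact_mod_cast this

/-- Instability of unidirectional flows of type I₀ for the 2D Navier-Stokes-Voigt
model: for all sufficiently small viscosity the linearized operator has a
positive eigenvalue with eigenvector in ℓ²_s(ℤ) for every `s ≥ 0`. -/
theorem instability_NavierStokesVoigt_typeI0 (α : ℝ) (hα : 0 < α) (p q : ℤ × ℤ)
    (hpq : wedge p q ≠ 0) (hI0 : typeI0 p q) :
    ∃ ν₀ > (0 : ℝ), ∀ ν : ℝ, 0 < ν → ν < ν₀ →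
      ∃ lam > (0 : ℝ), ∃ w : ℤ → ℝ, w ≠ 0 ∧ (∀ s : ℝ, 0 ≤ s → memL2s s w) ∧
        ∀ n : ℤ, rhoVoigt α p q (n - 1) * w (n - 1)
          - rhoVoigt α p q (n + 1) * w (n + 1)
          - ν * nsq (pt q p n) * (1 + α ^ 2 * nsq (pt q p n))⁻¹ * w n
          = lam * w n := by
  have hp1 : 1 ≤ nsq p := by
    apply nsq_ge_one
    by_contra h
    push Not at h
    apply hpq; simp [wedge, h.1, h.2]
  have hN : ∀ n, 1 ≤ nsq (pt q p n) := by
    intro n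
    apply nsq_ge_one
    by_contra h
    push Not at h
    apply hpq
    simp only [pt] at h
    unfold wedge
    linear_combination p.1 * h.2 - p.2 * h.1
  have hq0 : pt q p 0 = q := by simp [pt]
  have hden : ∀ n, 0 < 1 + α ^ 2 * nsq (pt q p n) := fun n => by
    have := hN n; positivity
  have hle : ∀ n : ℤ, rhoVoigt α p q n ≤ 1 / (1 + α ^ 2 * nsq (pt q p n)) := by
    intro n
    unfold rhoVoigt
    have := hden n
    have h2 : 0 ≤ nsq p / nsq (pt q p n) := div_nonneg (by linarith) (by linarith [hN n])
    gcongr; linarith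
  have hpos : ∀ n, n ≠ 0 → 0 < rhoVoigt α p q n := by
    intro n hn
    unfold rhoVoigt
    refine div_pos ?_ (hden n)
    rw [sub_pos, div_lt_one (by linarith [hN n])]
    exact hI0.2 n hn
  have hneg : rhoVoigt α p q 0 < 0 := by
    unfold rhoVoigt
    refine div_neg_of_neg_of_pos ?_ (hden 0)
    rw [sub_neg, one_lt_div (by linarith [hN 0]), hq0]
    exact hI0.1
  have hT : ∀ f : ℕ → ℤ, (∀ k, f k ≠ 0) → (∀ k, (f k : ℝ) ^ 2 = ((k : ℝ) + 1) ^ 2) →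
      Tendsto (fun k : ℕ => rhoVoigt α p q (f k)) atTop (𝓝 0) := by
    intro f hf hf2
    have h1 : Tendsto (fun k : ℕ => 1 + α ^ 2 * ((k : ℝ) / 2 - nsq q)) atTop atTop := by
      apply tendsto_atTop_add_const_left
      apply Tendsto.const_mul_atTop (by positivity)
      apply tendsto_atTop_add_const_right
      exact tendsto_natCast_atTop_atTop.atTop_div_const (by norm_num)
    have h2 : Tendsto (fun k : ℕ => 1 + α ^ 2 * nsq (pt q p (f k))) atTop atTop := by
      refine tendsto_atTop_mono (fun k => ?_) h1
      have h3 := nsq_pt_lower p q hp1 (f k)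
      rw [hf2] at h3
      have h4 : (k : ℝ) / 2 - nsq q ≤ nsq (pt q p (f k)) := by
        have : (0 : ℝ) ≤ k := Nat.cast_nonneg k
        nlinarith
      gcongr
    have h5 : Tendsto (fun k : ℕ => 1 / (1 + α ^ 2 * nsq (pt q p (f k)))) atTop (𝓝 0) := by
      simp only [one_div]; exact h2.inv_tendsto_atTop
    exact squeeze_zero (fun k => (hpos _ (hf k)).le) (fun k => hle _) h5
  obtain ⟨ν₀, h0, H⟩ := abstract_main (rhoVoigt α p q)
    (fun n => nsq (pt q p n) * (1 + α ^ 2 * nsq (pt q p n))⁻¹) hneg hpos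
    (fun n => mul_nonneg (by linarith [hN n]) (inv_nonneg.2 (hden n).le))
    (hT (fun k => (k : ℤ) + 1) (fun k => by omega) (fun k => by push_cast; ring))
    (hT (fun k => -((k : ℤ) + 1)) (fun k => by omega) (fun k => by push_cast; ring))
  refine ⟨ν₀, h0, fun ν h1 h2 => ?_⟩
  obtain ⟨l, hl, w, hw, hs, he⟩ := H ν h1 h2
  refine ⟨l, hl, w, hw, hs, fun n => ?_⟩
  rw [← he n]; ring
end
end

section
/- Fix α > 0. Let p, q ∈ ℤ² with p∧q ≠ 0 and suppose q is of type I₀ relative to p, and set ρ′_n = 1 − ((1+α²‖p‖²)‖p‖²) / ((1+α²‖q+np‖²)‖q+np‖²) and, for n ≠ 0 and ν > 0, e_n(0,ν,α) = ν‖q+np‖² / ((1+α²‖q+np‖²) ρ′_n). Then for every ν > 0 the limits f^s(0,ν,α) = lim_{k→∞}[e₁(0,ν,α); e₂(0,ν,α); …; e_k(0,ν,α)] and g^s(0,ν,α) = lim_{k→∞}[e_{−1}(0,ν,α); e_{−2}(0,ν,α); …; e_{−k}(0,ν,α)] exist, and f^s(0,ν,α) → 1 and g^s(0,ν,α) → 1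 as ν → 0⁺. -/
open Filter Finset Topology

noncomputable section

/-- ρ′_n for the α-models. -/
def rhoAlpha (α : ℝ) (p q : ℤ × ℤ) (n : ℤ) : ℝ :=
  1 - ((1 + α ^ 2 * nsq p) * nsq p) /
        ((1 + α ^ 2 * nsq (pt q p n)) * nsq (pt q p n))

/-- e_n(0,ν,α) for the second grade fluid model. -/
def ecoef (α : ℝ) (p q : ℤ × ℤ) (ν : ℝ) (n : ℤ) : ℝ :=
  ν * nsq (pt q p n) / ((1 + α ^ 2 * nsq (pt q p n)) * rhoAlpha α p q n)

def CF (u : ℕ → ℝ) (k : ℕ) : ℝ := cfL ((List.range k).map u)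

lemma CF_zero (u : ℕ → ℝ) : CF u 0 = 0 := by simp [CF, cfL]

lemma CF_succ (u : ℕ → ℝ) (k : ℕ) :
    CF u (k + 1) = 1 / (u 0 + CF (fun j => u (j + 1)) k) := by
  unfold CF
  rw [List.range_succ_eq_map, List.map_cons, List.map_map, cfL]
  rfl

lemma CF_nonneg (k : ℕ) : ∀ (u : ℕ → ℝ), (∀ j, 0 < u j) → 0 ≤ CF u k := by
  induction k with
  | zero => intro u _; rw [CF_zero]
  | succ k ih =>
    intro u hu
    rw [CF_succ]
    have := ih (fun j => u (j + 1)) (fun j => hu _)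
    have := hu 0
    positivity

lemma CF_le (m : ℝ) (hm : 0 < m) (k : ℕ) (u : ℕ → ℝ) (hu : ∀ j, m ≤ u j) : CF u k ≤ 1 / m := by
  cases k with
  | zero => rw [CF_zero]; positivity
  | succ k =>
    rw [CF_succ]
    have h1 := CF_nonneg k (fun j => u (j + 1)) (fun j => hm.trans_le (hu _))
    have h2 := hu 0
    exact one_div_le_one_div_of_le hm (by linarith)

lemma two_step (m a b x y : ℝ) (hm : 0 < m) (ha : m ≤ a) (hb : m ≤ b) (hx : 0 ≤ x) (hy : 0 ≤ y) :
    |1 / (a + 1 / (b + x)) - 1 / (a + 1 / (b + y))| ≤ (1 / (1 + m ^ 2)) * |x - y| := by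
  have ha0 : 0 < a := by linarith
  have hb0 : 0 < b := by linarith
  have h1 : 1 / (a + 1 / (b + x)) - 1 / (a + 1 / (b + y))
      = (x - y) * (1 / ((1 + a * (b + x)) * (1 + a * (b + y)))) := by
    field_simp
    ring
  have hab : m ^ 2 ≤ a * b := by nlinarith
  have h2 : 0 ≤ a * x := by positivity
  have h3 : 0 ≤ a * y := by positivity
  rw [h1, abs_mul, mul_comm]
  apply mul_le_mul_of_nonneg_right _ (abs_nonneg _)
  rw [abs_of_nonneg (by positivity)]
  apply one_div_le_one_div_of_le (by positivity)
  nlinarith [mul_nonneg h2 h3, sq_nonneg m, mul_nonneg (sq_nonneg m) (sq_nonneg m)]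

lemma CF_diff (m : ℝ) (hm : 0 < m) (n : ℕ) : ∀ (u : ℕ → ℝ), (∀ j, m ≤ u j) → ∀ k l : ℕ,
    |CF u (k + 2 * n) - CF u (l + 2 * n)| ≤ (1 / (1 + m ^ 2)) ^ n * (1 / m) := by
  induction n with
  | zero =>
    intro u hu k l
    have h0 : ∀ j, 0 < u j := fun j => hm.trans_le (hu j)
    simp only [mul_zero, add_zero, pow_zero, one_mul]
    rw [abs_le]
    have := CF_le m hm k u hu
    have := CF_le m hm l u hu
    have := CF_nonneg k u h0
    have := CF_nonneg l u h0
    constructor <;> linarith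
  | succ n ih =>
    intro u hu k l
    have e : ∀ k, k + 2 * (n + 1) = k + 2 * n + 1 + 1 := fun k => by ring
    rw [e, e, CF_succ, CF_succ _ (k + 2 * n), CF_succ u, CF_succ _ (l + 2 * n)]
    have hv : ∀ j, m ≤ u (j + 1 + 1) := fun j => hu _
    refine (two_step m _ _ _ _ hm (hu _) (hu _) (CF_nonneg _ _ fun j => hm.trans_le (hv j))
      (CF_nonneg _ _ fun j => hm.trans_le (hv j))).trans ?_
    rw [pow_succ' (1 / (1 + m ^ 2)) n, mul_assoc]
    exact mul_le_mul_of_nonneg_left (ih (fun j => u (j + 1 + 1)) hv k l) (by positivity)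

lemma CF_conv (m : ℝ) (hm : 0 < m) (u : ℕ → ℝ) (hu : ∀ j, m ≤ u j) :
    ∃ F, Tendsto (CF u) atTop (𝓝 F) := by
  apply cauchySeq_tendsto_of_complete
  rw [Metric.cauchySeq_iff']
  intro ε hε
  have hlt : 1 / (1 + m ^ 2) < 1 := by
    rw [div_lt_one (by positivity)]
    have : 0 < m ^ 2 := by positivity
    linarith
  obtain ⟨n, hn⟩ := exists_pow_lt_of_lt_one (show 0 < ε * m by positivity) hlt
  refine ⟨2 * n, fun k hk => ?_⟩
  obtain ⟨d, rfl⟩ := Nat.exists_eq_add_of_le' hk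
  have := CF_diff m hm n u hu d 0
  rw [zero_add] at this
  rw [Real.dist_eq]
  refine this.trans_lt ?_
  rw [mul_one_div, div_lt_iff₀ hm]
  exact hn

/-- Bounds for a positive bounded sequence with `F n = 1/(e n + F (n+1))`. -/
lemma tail_bound (m M r B : ℝ) (hm : 0 < m) (hr : M ≤ r * m) (hr1 : 1 ≤ r) (e F : ℕ → ℝ)
    (he : ∀ n, m ≤ e n ∧ e n ≤ M) (hF0 : ∀ n, 0 ≤ F n) (hFB : ∀ n, F n ≤ B)
    (hF : ∀ n, F n = 1 / (e n + F (n + 1))) :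
    ∀ n, 1 / (r + M) ≤ F n ∧ F n ≤ r := by
  have hbA : BddAbove (Set.range F) := ⟨B, by rintro _ ⟨n, rfl⟩; exact hFB n⟩
  have hbB : BddBelow (Set.range F) := ⟨0, by rintro _ ⟨n, rfl⟩; exact hF0 n⟩
  set U := ⨆ n, F n with hU
  set L := ⨅ n, F n with hL
  have hFU : ∀ n, F n ≤ U := fun n => le_ciSup hbA n
  have hLF : ∀ n, L ≤ F n := fun n => ciInf_le hbB n
  have hL0 : 0 ≤ L := le_ciInf hF0
  have hMm : m ≤ M := (he 0).1.trans (he 0).2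
  have hLU : L ≤ U := (hLF 0).trans (hFU 0)
  have h1 : U ≤ 1 / (m + L) := ciSup_le fun n => by
    rw [hF n]
    exact one_div_le_one_div_of_le (by linarith) (add_le_add (he n).1 (hLF _))
  have h2 : 1 / (M + U) ≤ L := le_ciInf fun n => by
    rw [hF n]
    have := hF0 (n + 1)
    have := (he n).1
    exact one_div_le_one_div_of_le (by linarith) (add_le_add (he n).2 (hFU _))
  rw [le_div_iff₀ (by linarith)] at h1
  have hMU : 0 < M + U := by linarith
  have hLpos : 0 < L := lt_of_lt_of_le (by positivity) h2
  rw [div_le_iff₀ hMU] at h2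
  have h3 : U ≤ r * L := by
    have : U * m ≤ (r * L) * m := by nlinarith
    exact le_of_mul_le_mul_right this hm
  have h4 : U * L ≤ 1 := by nlinarith
  have h5 : U ≤ r := by
    by_contra hcon
    push Not at hcon
    nlinarith
  intro n
  refine ⟨?_, (hFU n).trans h5⟩
  refine le_trans ?_ (hLF n)
  rw [div_le_iff₀ (by linarith)]
  nlinarith

lemma main_aux (c : ℕ → ℝ) (l : ℝ) (hl : 0 < l) (hpos : ∀ j, 0 < c j)
    (hc : Tendsto c atTop (𝓝 l)) :
    ∃ F : ℝ → ℝ, (∀ ν, 0 < ν → Tendsto (CF fun j => ν * c j) atTop (𝓝 (F ν))) ∧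
      Tendsto F (𝓝[>] 0) (𝓝 1) := by
  obtain ⟨M, hM⟩ := hc.bddAbove_range
  obtain ⟨K, hK⟩ := (hc.inv₀ hl.ne').bddAbove_range
  have hcM : ∀ j, c j ≤ M := fun j => hM ⟨j, rfl⟩
  have hcK : ∀ j, (c j)⁻¹ ≤ K := fun j => hK ⟨j, rfl⟩
  have hKpos : 0 < K := (inv_pos.2 (hpos 0)).trans_le (hcK 0)
  have hMpos : 0 < M := (hpos 0).trans_le (hcM 0)
  have hcm : ∀ j, K⁻¹ ≤ c j := fun j => inv_le_of_inv_le₀ (hpos j) (hcK j)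
  set m := K⁻¹ with hmdef
  have hm : 0 < m := inv_pos.2 hKpos
  have hex : ∀ (ν : ℝ) (n : ℕ), ∃ F, 0 < ν → Tendsto (CF fun j => ν * c (j + n)) atTop (𝓝 F) := by
    intro ν n
    by_cases hν : 0 < ν
    · obtain ⟨F, hF⟩ := CF_conv (ν * m) (by positivity) (fun j => ν * c (j + n))
        (fun j => mul_le_mul_of_nonneg_left (hcm _) hν.le)
      exact ⟨F, fun _ => hF⟩
    · exact ⟨0, fun h => absurd h hν⟩
  choose G hG using hex
  have hG0 : ∀ ν, 0 < ν → ∀ n, 0 ≤ G ν n := fun ν hν n =>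
    ge_of_tendsto' (hG ν n hν) fun k => CF_nonneg k _ fun j => mul_pos hν (hpos _)
  have hGB : ∀ ν, 0 < ν → ∀ n, G ν n ≤ 1 / (ν * m) := fun ν hν n =>
    le_of_tendsto' (hG ν n hν) fun k => CF_le (ν * m) (by positivity) k _
      fun j => mul_le_mul_of_nonneg_left (hcm _) hν.le
  have hGrec : ∀ ν, 0 < ν → ∀ n, G ν n = 1 / (ν * c n + G ν (n + 1)) := by
    intro ν hν n
    have h1 := (hG ν n hν).comp (tendsto_add_atTop_nat 1)
    have hne : ν * c n + G ν (n + 1) ≠ 0 :=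
      (add_pos_of_pos_of_nonneg (mul_pos hν (hpos n)) (hG0 ν hν _)).ne'
    have h2 := (tendsto_const_nhds (x := (1 : ℝ))).div ((hG ν (n + 1) hν).const_add (ν * c n)) hne
    refine tendsto_nhds_unique h1 (h2.congr fun k => ?_)
    simp only [Function.comp, CF_succ, zero_add, Pi.div_apply]
    simp only [add_assoc, add_comm 1 n]
  have key : ∀ r, 1 < r → ∃ A : ℝ, ∀ ν, 0 < ν → 1 / (r + A * ν) ≤ G ν 0 ∧ G ν 0 ≤ r + A * ν := by
    intro r hr
    obtain ⟨a, b, hb0, hal, hlb, hab⟩ : ∃ a b : ℝ, 0 < b ∧ b < l ∧ l < a ∧ a ≤ r * b := by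
      have h : 0 < (r - 1) / (r + 1) := div_pos (by linarith) (by linarith)
      refine ⟨l * (2 * r / (r + 1)), l * (2 / (r + 1)), by positivity, ?_, ?_, le_of_eq (by ring)⟩
      · apply mul_lt_of_lt_one_right hl
        rw [div_lt_one (by linarith)]; linarith
      · apply lt_mul_of_one_lt_right hl
        rw [one_lt_div (by linarith)]; linarith
    obtain ⟨N, hN⟩ := eventually_atTop.1 ((hc.eventually_lt_const hlb).and (hc.eventually_const_lt hal))
    have htail : ∀ ν, 0 < ν → 1 / (r + a * ν) ≤ G ν N ∧ G ν N ≤ r := by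
      intro ν hν
      have := tail_bound (ν * b) (ν * a) r (1 / (ν * m)) (by positivity) (by nlinarith) hr.le
        (fun n => ν * c (n + N)) (fun n => G ν (n + N))
        (fun n => ⟨mul_le_mul_of_nonneg_left (hN _ (by omega)).2.le hν.le,
          mul_le_mul_of_nonneg_left (hN _ (by omega)).1.le hν.le⟩)
        (fun n => hG0 ν hν _) (fun n => hGB ν hν _)
        (fun n => by
          have := hGrec ν hν (n + N)
          rw [this, show n + 1 + N = n + N + 1 by ring]) 0
      simpa [mul_comm] using this
    have hind : ∀ d, d ≤ N → ∃ A : ℝ, 0 ≤ A ∧ ∀ ν, 0 < ν →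
        1 / (r + A * ν) ≤ G ν (N - d) ∧ G ν (N - d) ≤ r + A * ν := by
      intro d
      induction d with
      | zero =>
        intro _
        refine ⟨a, by linarith, fun ν hν => ⟨(htail ν hν).1, (htail ν hν).2.trans ?_⟩⟩
        have : 0 < a * ν := mul_pos (by linarith) hν
        simpa using this.le
      | succ d ih =>
        intro hd
        obtain ⟨A, hA, h⟩ := ih (by omega)
        refine ⟨A + M, by positivity, fun ν hν => ?_⟩
        obtain ⟨h1, h2⟩ := h ν hν
        have e : N - (d + 1) + 1 = N - d := by omega
        have hrec := hGrec ν hν (N - (d + 1))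
        rw [e] at hrec
        have hp : 0 < ν * c (N - (d + 1)) := mul_pos hν (hpos _)
        have hle : ν * c (N - (d + 1)) ≤ M * ν := by
          rw [mul_comm]; exact mul_le_mul_of_nonneg_right (hcM _) hν.le
        have hAν : 0 ≤ A * ν := by positivity
        have hMν : 0 < M * ν := by positivity
        have hp2 : 0 < 1 / (r + A * ν) := by positivity
        rw [hrec]
        constructor
        · apply one_div_le_one_div_of_le (by linarith)
          linarith
        · have : 1 / (ν * c (N - (d + 1)) + G ν (N - d)) ≤ 1 / (1 / (r + A * ν)) :=
            one_div_le_one_div_of_le hp2 (by linarith)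
          rw [one_div_one_div] at this
          linarith
    obtain ⟨A, _, h⟩ := hind N le_rfl
    simp only [Nat.sub_self] at h
    exact ⟨A, h⟩
  refine ⟨fun ν => G ν 0, fun ν hν => by simpa using hG ν 0 hν, ?_⟩
  have hlim : ∀ r A : ℝ, Tendsto (fun ν : ℝ => r + A * ν) (𝓝[>] 0) (𝓝 r) := by
    intro r A
    have : Tendsto (fun ν : ℝ => r + A * ν) (𝓝 0) (𝓝 (r + A * 0)) :=
      Continuous.tendsto (by fun_prop) 0
    rw [mul_zero, add_zero] at this
    exact this.mono_left nhdsWithin_le_nhds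
  rw [tendsto_order]
  constructor
  · intro x hx
    obtain ⟨r, hr, hxr⟩ : ∃ r : ℝ, 1 < r ∧ x < 1 / r := by
      rcases le_or_gt x 0 with h | h
      · exact ⟨2, by norm_num, by norm_num; linarith⟩
      · obtain ⟨y, hy1, hy2⟩ := exists_between hx
        exact ⟨1 / y, by rw [one_lt_div (h.trans hy1)]; exact hy2, by rwa [one_div_one_div]⟩
    obtain ⟨A, hA⟩ := key r hr
    have := ((tendsto_const_nhds (x := (1 : ℝ))).div (hlim r A) (by linarith)).eventually_const_lt hxr
    filter_upwards [this, self_mem_nhdsWithin] with ν h1 h2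
    exact h1.trans_le (hA ν h2).1
  · intro x hx
    obtain ⟨r, hr, hrx⟩ := exists_between hx
    obtain ⟨A, hA⟩ := key r hr
    filter_upwards [(hlim r A).eventually_lt_const hrx, self_mem_nhdsWithin] with ν h1 h2
    exact (hA ν h2).2.trans_lt h1

lemma c_aux (α : ℝ) (hα : 0 < α) (p q : ℤ × ℤ) (hI0 : typeI0 p q) (s : ℕ → ℤ)
    (hs : ∀ j : ℕ, (j : ℝ) ≤ (s j : ℝ) ^ 2) (hs0 : ∀ j, s j ≠ 0) :
    ∃ F : ℝ → ℝ, (∀ ν, 0 < ν → Tendsto (CF fun j => ecoef α p q ν (s j)) atTop (𝓝 (F ν))) ∧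
      Tendsto F (𝓝[>] 0) (𝓝 1) := by
  have hq0 : 0 ≤ nsq q := by unfold nsq; positivity
  have hP : 0 < nsq p := hq0.trans_lt hI0.1
  have hn : Tendsto (fun j => nsq (pt q p (s j))) atTop atTop := by
    have h1 : Tendsto (fun j : ℕ => nsq p / 2 * (j : ℝ) - nsq q) atTop atTop :=
      tendsto_atTop_add_const_right _ _
        (tendsto_natCast_atTop_atTop.const_mul_atTop (by positivity))
    refine tendsto_atTop_mono (fun j => ?_) h1
    have h2 : nsq p / 2 * (j : ℝ) ≤ nsq p / 2 * (s j : ℝ) ^ 2 :=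
      mul_le_mul_of_nonneg_left (hs j) (by positivity)
    have h3 : nsq p / 2 * (s j : ℝ) ^ 2 - nsq q ≤ nsq (pt q p (s j)) := by
      simp only [nsq, pt]
      push_cast
      nlinarith [sq_nonneg (2 * (q.1 : ℝ) + s j * p.1), sq_nonneg (2 * (q.2 : ℝ) + s j * p.2)]
    linarith
  have hgt : ∀ j, nsq p < nsq (pt q p (s j)) := fun j => hI0.2 _ (hs0 j)
  have hrho : ∀ j, 0 < rhoAlpha α p q (s j) := by
    intro j
    have := hgt j
    unfold rhoAlpha
    rw [sub_pos, div_lt_one (by have := hP.trans this; positivity)]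
    gcongr
  have hpos : ∀ j, 0 < ecoef α p q 1 (s j) := by
    intro j
    have h1 := hP.trans (hgt j)
    have h2 := hrho j
    unfold ecoef
    positivity
  have hA : Tendsto (fun j => 1 + α ^ 2 * nsq (pt q p (s j))) atTop atTop :=
    tendsto_atTop_add_const_left _ _ (hn.const_mul_atTop (by positivity))
  have hr1 : Tendsto (fun j => rhoAlpha α p q (s j)) atTop (𝓝 1) := by
    have := (tendsto_const_nhds (x := (1 + α ^ 2 * nsq p) * nsq p)).div_atTop (hA.atTop_mul_atTop₀ hn)
    simpa [rhoAlpha] using this.const_sub 1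
  have hc : Tendsto (fun j => ecoef α p q 1 (s j)) atTop (𝓝 (1 / α ^ 2)) := by
    have h1 := (hn.inv_tendsto_atTop.add_const (α ^ 2)).mul hr1
    have h2 := (tendsto_const_nhds (x := (1 : ℝ))).div h1 (by positivity)
    rw [zero_add, mul_one] at h2
    refine h2.congr fun j => ?_
    have h3 := hP.trans (hgt j)
    have h4 := hrho j
    simp only [ecoef, Pi.inv_apply, Pi.div_apply]
    field_simp
  obtain ⟨F, h1, h2⟩ := main_aux _ _ (by positivity) hpos hc
  refine ⟨F, fun ν hν => ?_, h2⟩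
  convert h1 ν hν using 3
  simp only [ecoef]
  ring

lemma cast_aux (k : ℕ) (f : ℤ → ℝ) :
    List.map f (do let a ← List.range k; pure (a : ℤ)) = (List.range k).map fun j : ℕ => f (j : ℤ) := by
  induction List.range k with
  | nil => rfl
  | cons a t ih => simpa using ih

/-- For the second grade fluid model, the continued fractions `f^s(0,ν,α)` and
`g^s(0,ν,α)` exist for every `ν > 0` and tend to `1` as `ν → 0⁺`. -/
theorem secondGrade_continuedFraction_limit_one (α : ℝ) (hα : 0 < α)
    (p q : ℤ × ℤ) (hpq : wedge p q ≠ 0) (hI0 : typeI0 p q) :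
    ∃ Fs Gs : ℝ → ℝ,
      (∀ ν : ℝ, 0 < ν →
        Tendsto (fun k : ℕ =>
            cfL ((List.range k).map fun j => ecoef α p q ν (1 + (j : ℤ))))
          atTop (nhds (Fs ν)) ∧
        Tendsto (fun k : ℕ =>
            cfL ((List.range k).map fun j => ecoef α p q ν (-1 - (j : ℤ))))
          atTop (nhds (Gs ν))) ∧
      Tendsto Fs (nhdsWithin 0 (Set.Ioi 0)) (nhds 1) ∧
      Tendsto Gs (nhdsWithin 0 (Set.Ioi 0)) (nhds 1) := by
  obtain ⟨F, hF, hF1⟩ := c_aux α hα p q hI0 (fun j => 1 + (j : ℤ))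
    (fun j => by
      have : (0 : ℝ) ≤ j := Nat.cast_nonneg j
      push_cast
      nlinarith) (fun j => by omega)
  obtain ⟨G, hG, hG1⟩ := c_aux α hα p q hI0 (fun j => -1 - (j : ℤ))
    (fun j => by
      have : (0 : ℝ) ≤ j := Nat.cast_nonneg j
      push_cast
      nlinarith) (fun j => by omega)
  refine ⟨F, G, fun ν hν => ⟨(hF ν hν).congr fun k => ?_, (hG ν hν).congr fun k => ?_⟩, hF1, hG1⟩
  · rw [CF, cast_aux k (fun z : ℤ => ecoef α p q ν (1 + z))]
  · rw [CF, cast_aux k (fun z : ℤ => ecoef α p q ν (-1 - z))]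
end
end

section
/- Let (c_n)_{n≥1} be a sequence of positive real numbers converging to 1. Then for every x > 0 the limit F(x) = lim_{k→∞}[x c₁; x c₂; …; x c_k] exists, and F(x) → 1 as x → 0⁺. -/
open Filter Finset Topology

noncomputable section

def gcf (a : ℕ → ℝ) : ℕ → ℕ → ℝ
  | 0, _ => 0
  | k + 1, m => 1 / (a m + gcf a k (m + 1))

theorem cfL_eq_gcf (a : ℕ → ℝ) (k m : ℕ) :
    cfL ((List.range k).map fun j => a (m + j)) = gcf a k m := by
  induction k generalizing m with
  | zero => simp [cfL, gcf]
  | succ k ih =>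
    rw [List.range_succ_eq_map]
    simp only [List.map_cons, List.map_map, cfL, gcf, add_zero]
    rw [← ih (m + 1)]
    congr 3
    apply List.map_congr_left
    intro j _
    simp only [Function.comp]
    congr 1
    omega

theorem gcf_nonneg (a : ℕ → ℝ) (ha : ∀ n, 0 < a n) (k m : ℕ) : 0 ≤ gcf a k m := by
  induction k generalizing m with
  | zero => simp [gcf]
  | succ k ih =>
    have := ih (m + 1)
    have := ha m
    simp only [gcf]
    positivity

theorem gcf_le (a : ℕ → ℝ) (ha : ∀ n, 0 < a n) (d : ℝ) (hd : 0 < d) (k m : ℕ) (h : d ≤ a m) :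
    gcf a k m ≤ 1 / d := by
  cases k with
  | zero => simp only [gcf]; positivity
  | succ k =>
    have := gcf_nonneg a ha k (m + 1)
    simp only [gcf]
    exact one_div_le_one_div_of_le hd (by linarith)

theorem two_step_s18 (d a b u v : ℝ) (hd : 0 < d) (ha : d ≤ a) (hb : d ≤ b) (hu : 0 ≤ u)
    (hv : 0 ≤ v) :
    |1 / (a + 1 / (b + u)) - 1 / (a + 1 / (b + v))| ≤ (1 / (1 + d ^ 2)) * |u - v| := by
  have ha' : 0 < a := by linarith
  have hb' : 0 < b := by linarith
  have hab : d ^ 2 ≤ a * b := by nlinarith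
  have hau : 0 ≤ a * u := by positivity
  have hav : 0 ≤ a * v := by positivity
  have e : 1 / (a + 1 / (b + u)) - 1 / (a + 1 / (b + v))
      = (1 / ((a * b + a * u + 1) * (a * b + a * v + 1))) * (u - v) := by
    have h1 : b + u ≠ 0 := by positivity
    have h2 : b + v ≠ 0 := by positivity
    have h3 : a * b + a * u + 1 ≠ 0 := by positivity
    have h4 : a * b + a * v + 1 ≠ 0 := by positivity
    have e1 : 1 / (a + 1 / (b + u)) = (b + u) / (a * b + a * u + 1) := by
      have : a + 1 / (b + u) = (a * b + a * u + 1) / (b + u) := by field_simp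
      rw [this, one_div_div]
    have e2 : 1 / (a + 1 / (b + v)) = (b + v) / (a * b + a * v + 1) := by
      have : a + 1 / (b + v) = (a * b + a * v + 1) / (b + v) := by field_simp
      rw [this, one_div_div]
    rw [e1, e2, div_sub_div _ _ h3 h4, one_div, inv_mul_eq_div]
    congr 1
    ring
  rw [e, abs_mul]
  apply mul_le_mul_of_nonneg_right _ (abs_nonneg _)
  rw [abs_of_pos (by positivity)]
  apply one_div_le_one_div_of_le (by positivity)
  nlinarith [sq_nonneg d]

theorem gcf_contract (a : ℕ → ℝ) (ha : ∀ n, 0 < a n) (d : ℝ) (hd : 0 < d) (M : ℕ)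
    (h : ∀ n, M ≤ n → d ≤ a n) (i j m : ℕ) (hm : M ≤ m) :
    |gcf a (i + 2 * j) m - gcf a (2 * j) m| ≤ (1 / (1 + d ^ 2)) ^ j * (1 / d) := by
  induction j generalizing m with
  | zero =>
    have h1 := gcf_nonneg a ha i m
    have h2 := gcf_le a ha d hd i m (h m hm)
    have h3 : gcf a (2 * 0) m = 0 := rfl
    rw [h3, mul_zero, add_zero, sub_zero, pow_zero, one_mul, abs_of_nonneg h1]
    exact h2
  | succ j ih =>
    have e1 : i + 2 * (j + 1) = (i + 2 * j) + 1 + 1 := by ring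
    have e2 : 2 * (j + 1) = (2 * j) + 1 + 1 := by ring
    rw [e1, e2]
    have := two_step_s18 d (a m) (a (m + 1)) (gcf a (i + 2 * j) (m + 1 + 1))
      (gcf a (2 * j) (m + 1 + 1)) hd (h _ hm) (h _ (by omega)) (gcf_nonneg a ha _ _)
      (gcf_nonneg a ha _ _)
    refine this.trans ?_
    rw [pow_succ' _ j, mul_assoc]
    apply mul_le_mul_of_nonneg_left (ih (m + 1 + 1) (by omega))
    positivity

theorem gcf_conv_tail (a : ℕ → ℝ) (ha : ∀ n, 0 < a n) (d : ℝ) (hd : 0 < d) (M : ℕ)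
    (h : ∀ n, M ≤ n → d ≤ a n) (m : ℕ) (hm : M ≤ m) :
    ∃ l, Tendsto (fun k => gcf a k m) atTop (𝓝 l) := by
  apply cauchySeq_tendsto_of_complete
  rw [Metric.cauchySeq_iff']
  intro ε hε
  have hr : 1 / (1 + d ^ 2) < 1 := by
    rw [div_lt_one (by positivity)]
    have : 0 < d ^ 2 := by positivity
    linarith
  obtain ⟨j, hj⟩ := exists_pow_lt_of_lt_one (show 0 < ε * d by positivity) hr
  refine ⟨2 * j, fun n hn => ?_⟩
  obtain ⟨i, rfl⟩ := Nat.exists_eq_add_of_le' hn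
  rw [Real.dist_eq]
  refine (gcf_contract a ha d hd M h i j m hm).trans_lt ?_
  rw [mul_one_div, div_lt_iff₀ hd]
  exact hj

theorem gcf_step (a : ℕ → ℝ) (ha : ∀ n, 0 < a n) (m : ℕ) (l : ℝ)
    (h : Tendsto (fun k => gcf a k (m + 1)) atTop (𝓝 l)) :
    Tendsto (fun k => gcf a k m) atTop (𝓝 (1 / (a m + l))) := by
  have hl : 0 ≤ l := ge_of_tendsto' h (fun k => gcf_nonneg a ha k _)
  have := ha m
  rw [← tendsto_add_atTop_iff_nat 1]
  exact tendsto_const_nhds.div (tendsto_const_nhds.add h) (by positivity)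

theorem gcf_conv (a : ℕ → ℝ) (ha : ∀ n, 0 < a n) (d : ℝ) (hd : 0 < d) (M : ℕ)
    (h : ∀ n, M ≤ n → d ≤ a n) :
    ∃ f : ℕ → ℝ, (∀ m, Tendsto (fun k => gcf a k m) atTop (𝓝 (f m))) ∧
      (∀ m, 0 ≤ f m) ∧ ∀ m, f m = 1 / (a m + f (m + 1)) := by
  have key : ∀ t m, M ≤ m + t → ∃ l, Tendsto (fun k => gcf a k m) atTop (𝓝 l) := by
    intro t
    induction t with
    | zero => intro m hm; exact gcf_conv_tail a ha d hd M h m hm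
    | succ t ih =>
      intro m hm
      obtain ⟨l, hl⟩ := ih (m + 1) (by omega)
      exact ⟨_, gcf_step a ha m l hl⟩
  choose f hf using fun m => key M m (by omega)
  exact ⟨f, hf, fun m => ge_of_tendsto' (hf m) (fun k => gcf_nonneg a ha k _),
    fun m => tendsto_nhds_unique (hf m) (gcf_step a ha m _ (hf (m + 1)))⟩

theorem tail_bound_s18 (x e : ℝ) (hx : 0 < x) (he : 0 < e) (he1 : e < 1) (c f : ℕ → ℝ) (N : ℕ)
    (hc1 : ∀ n, N ≤ n → 1 - e ≤ c n) (hc2 : ∀ n, N ≤ n → c n ≤ 1 + e)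
    (hf0 : ∀ m, 0 ≤ f m) (hf : ∀ m, f m = 1 / (x * c m + f (m + 1))) (m : ℕ) (hm : N ≤ m) :
    (1 - 2 * x) * (1 - e) ≤ f m * (1 + e) ∧ f m * (1 - e) ≤ 1 + e := by
  set T : Set ℝ := f '' Set.Ici N with hT
  have hne : T.Nonempty := ⟨f N, N, Set.self_mem_Ici, rfl⟩
  have hbb : BddBelow T := ⟨0, by rintro _ ⟨n, _, rfl⟩; exact hf0 n⟩
  have hxe : 0 < x * (1 - e) := mul_pos hx (by linarith)
  have hlow : ∀ n, N ≤ n → x * (1 - e) ≤ x * c n := fun n hn =>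
    mul_le_mul_of_nonneg_left (hc1 n hn) hx.le
  have hupp : ∀ n, N ≤ n → x * c n ≤ x * (1 + e) := fun n hn =>
    mul_le_mul_of_nonneg_left (hc2 n hn) hx.le
  have hba : BddAbove T := by
    refine ⟨1 / (x * (1 - e)), ?_⟩
    rintro _ ⟨n, hn, rfl⟩
    rw [hf n]
    exact one_div_le_one_div_of_le hxe (by linarith [hlow n hn, hf0 (n + 1)])
  set S := sSup T
  set I := sInf T
  have hI : ∀ n, N ≤ n → I ≤ f n := fun n hn => csInf_le hbb ⟨n, hn, rfl⟩
  have hS : ∀ n, N ≤ n → f n ≤ S := fun n hn => le_csSup hba ⟨n, hn, rfl⟩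
  have hI0 : 0 ≤ I := le_csInf hne (by rintro _ ⟨n, _, rfl⟩; exact hf0 n)
  have hIS : I ≤ S := (hI m hm).trans (hS m hm)
  have h1 : S ≤ 1 / (x * (1 - e) + I) := by
    apply csSup_le hne
    rintro _ ⟨n, hn, rfl⟩
    rw [hf n]
    exact one_div_le_one_div_of_le (by linarith)
      (by linarith [hlow n hn, hI (n + 1) (Nat.le_succ_of_le hn)])
  have h2 : 1 / (x * (1 + e) + S) ≤ I := by
    apply le_csInf hne
    rintro _ ⟨n, hn, rfl⟩
    rw [hf n]
    exact one_div_le_one_div_of_le (by linarith [hlow n hn, hf0 (n + 1)])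
      (by linarith [hupp n hn, hS (n + 1) (Nat.le_succ_of_le hn)])
  rw [le_div_iff₀ (by linarith)] at h1
  rw [div_le_iff₀ (by nlinarith)] at h2
  have h3 : S * (1 - e) ≤ I * (1 + e) := by
    have : x * (S * (1 - e)) ≤ x * (I * (1 + e)) := by nlinarith
    exact le_of_mul_le_mul_left this hx
  have hSI : S * I ≤ 1 := by nlinarith
  have hI1 : I ≤ 1 := by nlinarith
  have hSI2 : 1 - 2 * x ≤ S * I := by
    have : I * (x * (1 + e)) ≤ 1 * (x * 2) := by
      apply mul_le_mul hI1 _ (by positivity) (by norm_num)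
      nlinarith
    nlinarith
  constructor
  · calc (1 - 2 * x) * (1 - e) ≤ (S * I) * (1 - e) :=
          mul_le_mul_of_nonneg_right hSI2 (by linarith)
      _ = (S * (1 - e)) * I := by ring
      _ ≤ (I * (1 + e)) * I := mul_le_mul_of_nonneg_right h3 hI0
      _ ≤ (I * (1 + e)) * 1 := mul_le_mul_of_nonneg_left hI1 (by positivity)
      _ ≤ f m * (1 + e) := by nlinarith [hI m hm]
  · nlinarith [hS m hm]

/-- If `(c_n)` is a sequence of positive reals converging to 1, then for every
`x > 0` the continued fraction `F(x) = [xc₁; xc₂; …]` converges, and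
`F(x) → 1` as `x → 0⁺`. -/
theorem continuedFraction_tendsto_one (c : ℕ → ℝ) (hc : ∀ n : ℕ, 1 ≤ n → 0 < c n)
    (hlim : Tendsto c atTop (nhds 1)) :
    ∃ F : ℝ → ℝ,
      (∀ x : ℝ, 0 < x →
        Tendsto (fun k : ℕ => cfL ((List.range k).map fun j => x * c (1 + j)))
          atTop (nhds (F x))) ∧
      Tendsto F (nhdsWithin 0 (Set.Ioi 0)) (nhds 1) := by
  set b : ℕ → ℝ := fun j => c (1 + j) with hb
  have hb0 : ∀ n, 0 < b n := fun n => hc _ (by omega)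
  have hblim : Tendsto b atTop (𝓝 1) := by
    have := (tendsto_add_atTop_iff_nat 1).2 hlim
    simpa [hb, add_comm] using this
  have hnear : ∀ e : ℝ, 0 < e → ∃ N, ∀ n, N ≤ n → 1 - e ≤ b n ∧ b n ≤ 1 + e := by
    intro e he
    obtain ⟨N, hN⟩ := Metric.tendsto_atTop.1 hblim e he
    refine ⟨N, fun n hn => ?_⟩
    have := hN n hn
    rw [Real.dist_eq, abs_lt] at this
    constructor <;> linarith
  obtain ⟨M, hM⟩ := hnear (1 / 2) (by norm_num)
  have hex : ∀ x : ℝ, ∃ f : ℕ → ℝ, 0 < x →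
      (∀ m, Tendsto (fun k => gcf (fun j => x * b j) k m) atTop (𝓝 (f m))) ∧
      (∀ m, 0 ≤ f m) ∧ ∀ m, f m = 1 / (x * b m + f (m + 1)) := by
    intro x
    by_cases hx : 0 < x
    · obtain ⟨f, hf⟩ := gcf_conv (fun j => x * b j) (fun n => mul_pos hx (hb0 n)) (x / 2)
        (by linarith) M (fun n hn => by have := (hM n hn).1; nlinarith)
      exact ⟨f, fun _ => hf⟩
    · exact ⟨fun _ => 0, fun h => absurd h hx⟩
  choose f hf using hex
  refine ⟨fun x => f x 0, fun x hx => ?_, ?_⟩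
  · have := (hf x hx).1 0
    simp only [← cfL_eq_gcf, zero_add] at this
    exact this
  have hpos : ∀ᶠ x : ℝ in 𝓝[>] 0, 0 < x := eventually_mem_nhdsWithin
  have hsmall : ∀ d : ℝ, 0 < d → ∀ᶠ x : ℝ in 𝓝[>] 0, x < d := fun d hd =>
    mem_nhdsWithin_of_mem_nhds (Iio_mem_nhds hd)
  have main : ∀ R : ℝ, 1 < R → ∀ R', R < R' →
      ∀ᶠ x : ℝ in 𝓝[>] 0, 1 / R' ≤ f x 0 ∧ f x 0 ≤ R' := by
    intro R hR
    have he : 0 < (R - 1) / (R + 1) := div_pos (by linarith) (by linarith)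
    have he1 : (R - 1) / (R + 1) < 1 := by rw [div_lt_one (by linarith)]; linarith
    have hRe : 1 + (R - 1) / (R + 1) = R * (1 - (R - 1) / (R + 1)) := by
      have : R + 1 ≠ 0 := by linarith
      field_simp
      ring
    set e := (R - 1) / (R + 1)
    obtain ⟨N, hN⟩ := hnear e he
    have step : ∀ m, (∀ R', R < R' → ∀ᶠ x : ℝ in 𝓝[>] 0, 1 / R' ≤ f x (m + 1) ∧ f x (m + 1) ≤ R')
        → (∀ R', R < R' → ∀ᶠ x : ℝ in 𝓝[>] 0, 1 / R' ≤ f x m ∧ f x m ≤ R') := by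
      intro m ih R' hR'
      have hd : 0 < (R' - R) / 2 / b m := div_pos (by linarith) (hb0 m)
      filter_upwards [ih ((R + R') / 2) (by linarith), hpos, hsmall _ hd] with x h hx hxs
      rw [lt_div_iff₀ (hb0 m)] at hxs
      have hxb : 0 < x * b m := mul_pos hx (hb0 m)
      obtain ⟨h1, h2⟩ := h
      have hq : 0 < 1 / ((R + R') / 2) := by apply one_div_pos.2; linarith
      rw [(hf x hx).2.2 m]
      constructor
      · exact one_div_le_one_div_of_le (by linarith) (by linarith)
      · calc 1 / (x * b m + f x (m + 1)) ≤ 1 / (1 / ((R + R') / 2)) :=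
              one_div_le_one_div_of_le hq (by linarith)
          _ = (R + R') / 2 := one_div_one_div _
          _ ≤ R' := by linarith
    have base : ∀ m, N ≤ m → ∀ R', R < R' →
        ∀ᶠ x : ℝ in 𝓝[>] 0, 1 / R' ≤ f x m ∧ f x m ≤ R' := by
      intro m hm R' hR'
      have hd : 0 < (1 - R / R') / 2 := by
        have : R / R' < 1 := by rw [div_lt_one (by linarith)]; exact hR'
        linarith
      filter_upwards [hpos, hsmall _ hd] with x hx hxs
      obtain ⟨h1, h2⟩ := tail_bound_s18 x e hx he he1 b (f x) N (fun n hn => (hN n hn).1)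
        (fun n hn => (hN n hn).2) (hf x hx).2.1 (hf x hx).2.2 m hm
      have h1e : 0 < 1 - e := by linarith
      rw [hRe] at h1 h2
      have h3 : 1 - 2 * x ≤ f x m * R := by
        apply le_of_mul_le_mul_right _ h1e
        linarith
      have h4 : f x m ≤ R := le_of_mul_le_mul_right h2 h1e
      refine ⟨?_, by linarith⟩
      have h5 : R * (1 / R') ≤ R * f x m := by
        rw [mul_one_div]; linarith
      exact le_of_mul_le_mul_left h5 (by linarith)
    have all : ∀ t m, N ≤ m + t → ∀ R', R < R' →
        ∀ᶠ x : ℝ in 𝓝[>] 0, 1 / R' ≤ f x m ∧ f x m ≤ R' := by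
      intro t
      induction t with
      | zero => intro m hm; exact base m hm
      | succ t ih => intro m hm; exact step m (ih (m + 1) (by omega))
    exact all N 0 (by omega)
  rw [Metric.tendsto_nhds]
  intro ε hε
  filter_upwards [main (1 + ε / 4) (by linarith) (1 + ε / 2) (by linarith)] with x hx
  obtain ⟨h1, h2⟩ := hx
  have h3 : 1 - ε / 2 ≤ 1 / (1 + ε / 2) := by
    rw [le_div_iff₀ (by linarith)]
    nlinarith
  rw [Real.dist_eq, abs_lt]
  constructor <;> linarith
end
end
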